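/- Let d ≥ 1, p ∈ (1, ∞), 0 < β ≤ (d+2)/p. Then there exists a constant N = N(d, p, β) such that for every R ∈ (0, ∞), every ε ∈ (0, 1], and every u ∈ C_0^∞(ℝ^{d+1}), one has ‖Du‖_{E_{p,β}(C_R)} ≤ N ε R ‖ |∂_t u| + |D²u| ‖_{E_{p,β}(C_R)} + N ε^{-1} R^{-1} ‖u‖_{E_{p,β}(C_R)}. -/

import Mathlib

open MeasureTheory Set ENNReal Filter

noncomputable section

/-- Euclidean space `ℝ^d`. -/
abbrev Ed (d : ℕ) := EuclideanSpace ℝ (Fin d)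

/-- Points of `ℝ^{d+1}`: `z = (t, x)`. -/
abbrev Pt (d : ℕ) := ℝ × Ed d

/-- The parabolic cylinder `C_ρ(t,x)`. -/
def pCyl (d : ℕ) (ρ : ℝ) (z : Pt d) : Set (Pt d) :=
  {w | dist z.2 w.2 < ρ ∧ z.1 ≤ w.1 ∧ w.1 < z.1 + ρ ^ 2}

/-- The average `⨍_{C_ρ(z)} f`. -/
def pAvg (d : ℕ) (ρ : ℝ) (z : Pt d) (f : Pt d → ℝ≥0∞) : ℝ≥0∞ :=
  (volume (pCyl d ρ z))⁻¹ * ∫⁻ w in pCyl d ρ z, f w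

/-- The fractional maximal function `M_β f`. -/
def Mbeta (d : ℕ) (β : ℝ) (f : Pt d → ℝ≥0∞) (z : Pt d) : ℝ≥0∞ :=
  ⨆ (ρ : ℝ) (_ : 0 < ρ), ENNReal.ofReal (ρ ^ β) * pAvg d ρ z f

/-- The kernel `p_α(s, r)`. -/
def pKer (d : ℕ) (α : ℝ) (s r : ℝ) : ℝ≥0∞ :=
  if 0 < s then ENNReal.ofReal (s ^ (-(((d : ℝ) + 2 - α) / 2)) * Real.exp (-(r ^ 2) / s)) else 0

/-- The parabolic potential `P_α f`. -/
def Palpha (d : ℕ) (α : ℝ) (f : Pt d → ℝ≥0∞) (z : Pt d) : ℝ≥0∞ :=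
  ∫⁻ w : Pt d, pKer d α w.1 ‖w.2‖ * f (z.1 + w.1, z.2 + w.2)

/-- The parabolic Morrey norm `‖f‖_{E_{p,β}(Q)}`. -/
def MorreyNorm (d : ℕ) (p β : ℝ) (Q : Set (Pt d)) (f : Pt d → ℝ≥0∞) : ℝ≥0∞ :=
  ⨆ (ρ : ℝ) (_ : 0 < ρ) (z : Pt d) (_ : z ∈ Q),
    ENNReal.ofReal (ρ ^ β) * (pAvg d ρ z fun w => Q.indicator f w ^ p) ^ (1 / p)

/-- The `L_p`-norm on `ℝ^{d+1}`. -/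
def LpNormE (d : ℕ) (p : ℝ) (f : Pt d → ℝ≥0∞) : ℝ≥0∞ :=
  (∫⁻ z : Pt d, f z ^ p) ^ (1 / p)

/-- The mixed norm `‖f‖_{L_{q₁,q₂}}`. -/
def MixedNorm (d : ℕ) (q₁ q₂ : ℝ) (f : Pt d → ℝ≥0∞) : ℝ≥0∞ :=
  (∫⁻ t : ℝ, (∫⁻ x : Ed d, f (t, x) ^ q₁) ^ (q₂ / q₁)) ^ (1 / q₂)

/-- The normalized mixed norm `‖f‖_{L_{q₁,q₂}(Γ)}`. -/
def MixedNormOn (d : ℕ) (q₁ q₂ : ℝ) (Γ : Set (Pt d)) (f : Pt d → ℝ≥0∞) : ℝ≥0∞ :=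
  (MixedNorm d q₁ q₂ (Γ.indicator 1))⁻¹ * MixedNorm d q₁ q₂ (Γ.indicator f)

/-- The mixed-norm parabolic Morrey norm `‖f‖_{E_{q₁,q₂,β}(Q)}`. -/
def MixedMorrey (d : ℕ) (q₁ q₂ β : ℝ) (Q : Set (Pt d)) (f : Pt d → ℝ≥0∞) : ℝ≥0∞ :=
  ⨆ (ρ : ℝ) (_ : 0 < ρ) (z : Pt d) (_ : z ∈ Q),
    ENNReal.ofReal (ρ ^ β) * MixedNormOn d q₁ q₂ (pCyl d ρ z) (Q.indicator f)

/-- The symmetric parabolic maximal function `M̂ f`. -/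
def pMax (d : ℕ) (f : Pt d → ℝ≥0∞) (z : Pt d) : ℝ≥0∞ :=
  ⨆ (r : ℝ) (_ : 0 < r) (w : Pt d) (_ : z ∈ pCyl d r w), pAvg d r w f

/-- The time derivative `∂_t u`. -/
def timeDeriv (d : ℕ) (u : Pt d → ℝ) (z : Pt d) : ℝ :=
  fderiv ℝ u z ((1 : ℝ), (0 : Ed d))

/-- The spatial partial derivative `D_i u`. -/
def spDeriv (d : ℕ) (i : Fin d) (u : Pt d → ℝ) (z : Pt d) : ℝ :=
  fderiv ℝ u z ((0 : ℝ), EuclideanSpace.single i (1 : ℝ))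

/-- The Euclidean norm of the spatial gradient `|Du|`. -/
def gradNorm (d : ℕ) (u : Pt d → ℝ) (z : Pt d) : ℝ :=
  Real.sqrt (∑ i : Fin d, spDeriv d i u z ^ 2)

/-- The spatial Laplacian `Δu`. -/
def lap (d : ℕ) (u : Pt d → ℝ) (z : Pt d) : ℝ :=
  ∑ i : Fin d, spDeriv d i (spDeriv d i u) z

/-- The (Frobenius) norm of the spatial Hessian `|D²u|`. -/
def hessNorm (d : ℕ) (u : Pt d → ℝ) (z : Pt d) : ℝ :=
  Real.sqrt (∑ i : Fin d, ∑ j : Fin d, spDeriv d i (spDeriv d j u) z ^ 2)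



/-! ### Helper lemmas -/

lemma aux_k_iff {p : ℝ} (hp : 1 < p) (k X C : ℝ≥0∞) :
    k * X ^ (1 / p) ≤ C ↔ k ^ p * X ≤ C ^ p := by
  have h0 : 0 < p := by linarith
  rw [← ENNReal.rpow_le_rpow_iff h0, ENNReal.mul_rpow_of_nonneg _ _ h0.le, ← ENNReal.rpow_mul,
    one_div, inv_mul_cancel₀ h0.ne', ENNReal.rpow_one]

lemma aux_le_morrey {d : ℕ} {p β : ℝ} (hp : 1 < p) {Q : Set (Pt d)} {f : Pt d → ℝ≥0∞} {C : ℝ≥0∞} :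
    MorreyNorm d p β Q f ≤ C ↔ ∀ ρ : ℝ, 0 < ρ → ∀ z ∈ Q,
      ENNReal.ofReal (ρ ^ β) ^ p * (pAvg d ρ z fun w => Q.indicator f w ^ p) ≤ C ^ p := by
  simp only [MorreyNorm, iSup_le_iff, aux_k_iff hp]

lemma aux_morrey_mono {d : ℕ} {p β : ℝ} (hp : 1 < p) {Q : Set (Pt d)} {f g : Pt d → ℝ≥0∞}
    (h : ∀ w ∈ Q, f w ≤ g w) : MorreyNorm d p β Q f ≤ MorreyNorm d p β Q g := by
  rw [aux_le_morrey hp]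
  intro ρ hρ z hz
  refine le_trans ?_ ((aux_le_morrey hp).1 le_rfl ρ hρ z hz)
  unfold pAvg
  gcongr with w
  by_cases hw : w ∈ Q
  · simp only [hw, indicator_of_mem]
    exact ENNReal.rpow_le_rpow (h w hw) (by linarith)
  · simp [hw]

lemma aux_morrey_add {d : ℕ} {p β : ℝ} (hp : 1 < p) {Q : Set (Pt d)} (hQ : MeasurableSet Q)
    {f g : Pt d → ℝ≥0∞} (hf : Measurable f) (hg : Measurable g) :
    MorreyNorm d p β Q (fun w => f w + g w) ≤ MorreyNorm d p β Q f + MorreyNorm d p β Q g := by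
  have h0 : 0 ≤ 1 / p := by positivity
  have key : ∀ (h : Pt d → ℝ≥0∞), ∀ ρ : ℝ, 0 < ρ → ∀ z ∈ Q,
      ENNReal.ofReal (ρ ^ β) * (pAvg d ρ z fun w => Q.indicator h w ^ p) ^ (1 / p)
        ≤ MorreyNorm d p β Q h := by
    intro h ρ hρ z hz
    unfold MorreyNorm
    exact le_iSup₂_of_le ρ hρ (le_iSup₂_of_le z hz le_rfl)
  conv_lhs => unfold MorreyNorm
  simp only [iSup_le_iff]
  intro ρ hρ z hz
  refine le_trans ?_ (add_le_add (key f ρ hρ z hz) (key g ρ hρ z hz))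
  rw [← mul_add]
  gcongr
  unfold pAvg
  rw [ENNReal.mul_rpow_of_nonneg _ _ h0, ENNReal.mul_rpow_of_nonneg _ _ h0,
    ENNReal.mul_rpow_of_nonneg _ _ h0, ← mul_add]
  gcongr
  have := ENNReal.lintegral_Lp_add_le (μ := volume.restrict (pCyl d ρ z))
    (hf.indicator hQ).aemeasurable (hg.indicator hQ).aemeasurable hp.le
  have e : ∀ w, Q.indicator (fun w => f w + g w) w = (Q.indicator f + Q.indicator g) w := by
    intro w
    by_cases hw : w ∈ Q <;> simp [hw]
  simp only [e]
  exact this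

lemma aux_morrey_const {d : ℕ} {p β : ℝ} (hp : 1 < p) {Q : Set (Pt d)} (c : ℝ≥0∞) (hc : c ≠ ∞)
    (f : Pt d → ℝ≥0∞) :
    MorreyNorm d p β Q (fun w => c * f w) ≤ c * MorreyNorm d p β Q f := by
  have h0 : 0 ≤ p := by linarith
  rw [aux_le_morrey hp]
  intro ρ hρ z hz
  rw [ENNReal.mul_rpow_of_nonneg _ _ h0]
  refine le_trans ?_ (mul_le_mul_right ((aux_le_morrey hp).1 le_rfl ρ hρ z hz) (c ^ p))
  unfold pAvg
  have : ∀ w, Q.indicator (fun w => c * f w) w ^ p = c ^ p * Q.indicator f w ^ p := by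
    intro w
    rw [← ENNReal.mul_rpow_of_nonneg _ _ h0]
    by_cases hw : w ∈ Q <;> simp [hw]
  simp only [this]
  rw [lintegral_const_mul' _ _ (by simp [hc, h0])]
  apply le_of_eq
  ring

lemma aux_jensen {p : ℝ} (hp : 1 < p) {f : ℝ → ℝ≥0∞} (hf : Measurable f) :
    (∫⁻ τ in Icc (0:ℝ) 1, f τ) ^ p ≤ ∫⁻ τ in Icc (0:ℝ) 1, f τ ^ p := by
  have h0 : 0 < p := by linarith
  have := ENNReal.lintegral_mul_le_Lp_mul_Lq (volume.restrict (Icc (0:ℝ) 1))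
    (Real.HolderConjugate.conjExponent hp) hf.aemeasurable
    (aemeasurable_const (b := (1:ℝ≥0∞)))
  simp at this
  calc _ ≤ ((∫⁻ τ in Icc (0:ℝ) 1, f τ ^ p) ^ p⁻¹) ^ p := ENNReal.rpow_le_rpow this h0.le
    _ = _ := by rw [← ENNReal.rpow_mul, inv_mul_cancel₀ h0.ne', ENNReal.rpow_one]

lemma aux_morrey_int {d : ℕ} {p β : ℝ} (hp : 1 < p) {Q : Set (Pt d)} (hQ : MeasurableSet Q)
    {f : ℝ → Pt d → ℝ≥0∞} (hf : Measurable (Function.uncurry f)) (C : ℝ≥0∞)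
    (h : ∀ τ ∈ Icc (0:ℝ) 1, MorreyNorm d p β Q (f τ) ≤ C) :
    MorreyNorm d p β Q (fun w => ∫⁻ τ in Icc (0:ℝ) 1, f τ w) ≤ C := by
  have h0 : 0 < p := by linarith
  rw [aux_le_morrey hp]
  intro ρ hρ z hz
  have hf2 : Measurable (fun q : Pt d × ℝ => Q.indicator (f q.2) q.1 ^ p) := by
    have : (fun q : Pt d × ℝ => Q.indicator (f q.2) q.1 ^ p) =
      (fun q : Pt d × ℝ => ((Prod.fst ⁻¹' Q).indicator (fun q => f q.2 q.1) q) ^ p) := by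
      funext q
      by_cases hq : q.1 ∈ Q <;> simp [hq]
    rw [this]
    exact ((hf.comp measurable_swap).indicator (measurable_fst hQ)).pow_const p
  calc _ ≤ ENNReal.ofReal (ρ ^ β) ^ p * (pAvg d ρ z fun w =>
        ∫⁻ τ in Icc (0:ℝ) 1, Q.indicator (f τ) w ^ p) := by
        unfold pAvg
        gcongr with w
        by_cases hw : w ∈ Q
        · simp only [hw, indicator_of_mem]
          exact aux_jensen hp (hf.comp (measurable_id.prodMk measurable_const))
        · simp [hw, h0]
    _ = ∫⁻ τ in Icc (0:ℝ) 1, ENNReal.ofReal (ρ ^ β) ^ p *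
          (pAvg d ρ z fun w => Q.indicator (f τ) w ^ p) := by
        unfold pAvg
        rw [lintegral_lintegral_swap hf2.aemeasurable]
        have hm : Measurable fun τ => ∫⁻ w in pCyl d ρ z, Q.indicator (f τ) w ^ p :=
          Measurable.lintegral_prod_left' (f := fun q : Pt d × ℝ => Q.indicator (f q.2) q.1 ^ p) hf2
        rw [lintegral_const_mul _ (hm.const_mul _), lintegral_const_mul _ hm]
    _ ≤ ∫⁻ τ in Icc (0:ℝ) 1, C ^ p := by
        apply setLIntegral_mono' measurableSet_Icc
        intro τ hτ
        exact (aux_le_morrey hp).1 (h τ hτ) ρ hρ z hz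
    _ = C ^ p := by simp

/-- The contraction towards `y` in the space variable. -/
def auxPhi (d : ℕ) (s : ℝ) (y : Ed d) (w : Pt d) : Pt d := (w.1, (1 - s) • w.2 + s • y)

lemma aux_Phi_mem {d : ℕ} {s R : ℝ} {y : Ed d} (hs : 0 ≤ s) (hs1 : s ≤ 1 / 2) (hy : ‖y‖ < R)
    {w : Pt d} (hw : w ∈ pCyl d R 0) : auxPhi d s y w ∈ pCyl d R 0 := by
  simp only [pCyl, auxPhi, mem_setOf_eq, Prod.fst_zero, Prod.snd_zero, dist_zero_left] at hw ⊢
  refine ⟨?_, hw.2⟩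
  have h1 : ‖(1 - s) • w.2 + s • y‖ ≤ (1 - s) * ‖w.2‖ + s * ‖y‖ := by
    refine (norm_add_le _ _).trans ?_
    rw [norm_smul, norm_smul, Real.norm_of_nonneg hs, Real.norm_of_nonneg (by linarith)]
  nlinarith [hw.1]

lemma aux_Phi_mem2 {d : ℕ} {s ρ : ℝ} {y : Ed d} (hs : 0 ≤ s) (hs1 : s ≤ 1 / 2)
    {w z : Pt d} (hw : w ∈ pCyl d ρ z) : auxPhi d s y w ∈ pCyl d ρ (auxPhi d s y z) := by
  simp only [pCyl, auxPhi, mem_ofPred_eq] at hw ⊢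
  refine ⟨?_, hw.2⟩
  rw [dist_add_right, dist_smul₀, Real.norm_of_nonneg (by linarith)]
  have := dist_nonneg (x := z.2) (y := w.2)
  nlinarith [hw.1]

lemma aux_meas_cyl (d : ℕ) (ρ : ℝ) (z : Pt d) : MeasurableSet (pCyl d ρ z) := by
  have : pCyl d ρ z = Ico z.1 (z.1 + ρ ^ 2) ×ˢ Metric.ball z.2 ρ := by
    ext w
    simp [pCyl, dist_comm, and_comm]
  rw [this]
  exact measurableSet_Ico.prod measurableSet_ball

lemma aux_vol_cyl (d : ℕ) (ρ : ℝ) (z z' : Pt d) : volume (pCyl d ρ z) = volume (pCyl d ρ z') := by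
  have : pCyl d ρ z = (fun w => w + (z' - z)) ⁻¹' pCyl d ρ z' := by
    ext w
    simp only [pCyl, mem_setOf_eq, mem_preimage, Prod.fst_add, Prod.snd_add, Prod.fst_sub,
      Prod.snd_sub]
    have h1 : dist z'.2 (w.2 + (z'.2 - z.2)) = dist z.2 w.2 := by
      rw [dist_eq_norm, dist_eq_norm]; congr 1; abel
    rw [h1]
    constructor
    · rintro ⟨a, b, c⟩; exact ⟨a, by linarith, by linarith⟩
    · rintro ⟨a, b, c⟩; exact ⟨a, by linarith, by linarith⟩
  rw [this, Measure.volume_eq_prod, measure_preimage_add_right]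

lemma aux_Phi_lint {d : ℕ} {s : ℝ} {y : Ed d} (hs : 0 ≤ s) (hs1 : s ≤ 1 / 2)
    {h : Pt d → ℝ≥0∞} (hh : Measurable h) :
    ∫⁻ w, h (auxPhi d s y w) ≤ 2 ^ d * ∫⁻ w, h w := by
  have hΦ : Measurable (auxPhi d s y) := by
    unfold auxPhi; fun_prop
  have hs0 : (1 - s) ≠ 0 := by linarith
  have hhΦ : Measurable fun w => h (auxPhi d s y w) := hh.comp hΦ
  rw [Measure.volume_eq_prod, lintegral_prod _ hhΦ.aemeasurable,
    lintegral_prod _ hh.aemeasurable, ← lintegral_const_mul _ hh.lintegral_prod_right']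
  gcongr with t
  have hht : Measurable fun x : Ed d => h (t, x) := hh.comp (by fun_prop)
  have e1 : ∫⁻ x : Ed d, h (t, (1 - s) • x + s • y) =
      ENNReal.ofReal |((1 - s) ^ d)⁻¹| * ∫⁻ x : Ed d, h (t, x) := by
    have h2 := Measure.map_addHaar_smul (volume : Measure (Ed d)) hs0
    have h3 : ∫⁻ x : Ed d, h (t, (1 - s) • x + s • y) =
      ∫⁻ x, h (t, x + s • y) ∂(Measure.map (fun x => (1 - s) • x) (volume : Measure (Ed d))) := by
      rw [lintegral_map (by fun_prop) (by fun_prop)]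
    rw [h3, h2, lintegral_smul_measure]
    rw [lintegral_add_right_eq_self (fun x => h (t, x))]
    simp
  simp only [auxPhi]
  rw [e1]
  gcongr
  have : |((1 - s) ^ d)⁻¹| ≤ 2 ^ d := by
    rw [abs_of_nonneg (by have : 0 ≤ 1 - s := by linarith
                          positivity), ← inv_pow]
    gcongr
    · rw [inv_nonneg]; linarith
    · rw [inv_le_comm₀ (by linarith) (by norm_num)]; linarith
  calc _ ≤ ENNReal.ofReal (2 ^ d) := ENNReal.ofReal_le_ofReal this
    _ = 2 ^ d := by rw [ENNReal.ofReal_pow (by norm_num)]; simp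

lemma aux_morrey_Phi {d : ℕ} {p β : ℝ} (hp : 1 < p) {s R : ℝ} {y : Ed d} (hs : 0 ≤ s)
    (hs1 : s ≤ 1 / 2) (hy : ‖y‖ < R) {f : Pt d → ℝ≥0∞} (hf : Measurable f) :
    MorreyNorm d p β (pCyl d R 0) (fun w => f (auxPhi d s y w)) ≤
      2 ^ d * MorreyNorm d p β (pCyl d R 0) f := by
  have h0 : 0 < p := by linarith
  rw [aux_le_morrey hp]
  intro ρ hρ z hz
  have key := (aux_le_morrey (β := β) hp (f := f)).1 le_rfl ρ hρ _ (aux_Phi_mem hs hs1 hy hz)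
  rw [ENNReal.mul_rpow_of_nonneg _ _ h0.le]
  calc _ ≤ ENNReal.ofReal (ρ ^ β) ^ p * (2 ^ d * pAvg d ρ (auxPhi d s y z)
          (fun w => (pCyl d R 0).indicator f w ^ p)) := by
        gcongr
        unfold pAvg
        rw [aux_vol_cyl d ρ z (auxPhi d s y z), mul_left_comm]
        gcongr
        rw [← lintegral_indicator (aux_meas_cyl _ _ _), ← lintegral_indicator (aux_meas_cyl _ _ _)]
        refine le_trans ?_ (aux_Phi_lint (y := y) hs hs1 (Measurable.indicator
          ((hf.indicator (aux_meas_cyl _ _ _)).pow_const p) (aux_meas_cyl _ _ _)))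
        refine lintegral_mono fun w => ?_
        by_cases hw : w ∈ pCyl d ρ z
        · by_cases hw2 : w ∈ pCyl d R 0
          · simp [hw, hw2, aux_Phi_mem hs hs1 hy hw2, aux_Phi_mem2 hs hs1 hw]
          · rw [indicator_of_mem hw, indicator_of_notMem hw2, ENNReal.zero_rpow_of_pos h0]
            exact zero_le
        · simp [hw]
    _ = 2 ^ d * (ENNReal.ofReal (ρ ^ β) ^ p * pAvg d ρ (auxPhi d s y z)
          (fun w => (pCyl d R 0).indicator f w ^ p)) := by ring
    _ ≤ (2 ^ d) ^ p * MorreyNorm d p β (pCyl d R 0) f ^ p := by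
        gcongr
        have h1 : (1 : ℝ≥0∞) ≤ 2 ^ d := one_le_pow₀ (by norm_num)
        simpa using ENNReal.rpow_le_rpow_of_exponent_le h1 hp.le

lemma aux_taylor {G G1 G2 : ℝ → ℝ} (h1 : ∀ τ, HasDerivAt G (G1 τ) τ)
    (h2 : ∀ τ, HasDerivAt G1 (G2 τ) τ) (hc : Continuous G2) :
    ENNReal.ofReal |G1 0| ≤ ENNReal.ofReal |G 0| + ENNReal.ofReal |G 1| +
      ∫⁻ τ in Icc (0:ℝ) 1, ENNReal.ofReal |G2 τ| := by
  obtain ⟨ξ, hξ, e⟩ := exists_hasDerivAt_eq_slope G G1 (zero_lt_one)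
    (fun x _ => (h1 x).continuousAt.continuousWithinAt) (fun x _ => h1 x)
  have e2 : ∫ τ in (0:ℝ)..ξ, G2 τ = G1 ξ - G1 0 :=
    intervalIntegral.integral_eq_sub_of_hasDerivAt (fun x _ => h2 x) (hc.intervalIntegrable _ _)
  have e3 : |G1 ξ - G1 0| ≤ ∫ τ in Icc (0:ℝ) 1, |G2 τ| := by
    rw [← e2, intervalIntegral.integral_of_le hξ.1.le]
    refine (abs_integral_le_integral_abs).trans ?_
    refine setIntegral_mono_set hc.abs.integrableOn_Icc (ae_of_all _ fun _ => abs_nonneg _) ?_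
    exact (HasSubset.Subset.eventuallyLE (fun x hx => ⟨hx.1.le, hx.2.trans hξ.2.le⟩))
  have e4 : |G1 0| ≤ |G 0| + |G 1| + ∫ τ in Icc (0:ℝ) 1, |G2 τ| := by
    have e' : G1 ξ = G 1 - G 0 := by simpa using e
    have : G1 0 = G 1 - G 0 - (G1 ξ - G1 0) := by rw [← e']; ring
    calc |G1 0| = |G 1 - G 0 - (G1 ξ - G1 0)| := by rw [← this]
      _ ≤ |G 1 - G 0| + |G1 ξ - G1 0| := abs_sub _ _
      _ ≤ (|G 1| + |G 0|) + _ := add_le_add (abs_sub _ _) e3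
      _ = _ := by ring
  rw [← ofReal_integral_eq_lintegral_ofReal hc.abs.integrableOn_Icc
    (ae_of_all _ fun _ => abs_nonneg _), ← ENNReal.ofReal_add (abs_nonneg _) (abs_nonneg _),
    ← ENNReal.ofReal_add (by positivity) (integral_nonneg fun _ => abs_nonneg _)]
  exact ENNReal.ofReal_le_ofReal e4

lemma aux_sp_smooth {d : ℕ} {u : Pt d → ℝ} (hu : ContDiff ℝ (⊤ : ℕ∞) u) (i : Fin d) :
    ContDiff ℝ (⊤ : ℕ∞) (spDeriv d i u) := by
  unfold spDeriv
  exact (hu.fderiv_right (by simp)).clm_apply contDiff_const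

lemma aux_fderiv_sp {d : ℕ} (u : Pt d → ℝ) (z : Pt d) (v : Ed d) :
    fderiv ℝ u z ((0:ℝ), v) = ∑ j, v j * spDeriv d j u z := by
  have : ((0:ℝ), v) = ∑ j, v j • ((0:ℝ), EuclideanSpace.single j (1:ℝ)) := by
    refine Prod.ext ?_ ?_
    · simp [Prod.fst_sum]
    · ext k
      simp [Prod.snd_sum, Pi.single_apply, Finset.sum_apply]
  rw [this, map_sum]
  refine Finset.sum_congr rfl fun j _ => ?_
  rw [map_smul, smul_eq_mul, spDeriv]

lemma aux_Phi_deriv {d : ℕ} {u : Pt d → ℝ} (hu : ContDiff ℝ (⊤ : ℕ∞) u) (σ : ℝ) (y : Ed d)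
    (w : Pt d) (τ : ℝ) : HasDerivAt (fun τ => u (auxPhi d (σ * τ) y w))
      (σ * ∑ j, (y - w.2) j * spDeriv d j u (auxPhi d (σ * τ) y w)) τ := by
  have h1 : HasDerivAt (fun τ => auxPhi d (σ * τ) y w) ((0:ℝ), σ • (y - w.2)) τ := by
    unfold auxPhi
    refine (hasDerivAt_const τ w.1).prodMk ?_
    have ha : HasDerivAt (fun τ : ℝ => σ * τ) σ τ := by
      simpa using (hasDerivAt_id τ).const_mul σ
    have := ((ha.const_sub 1).smul_const w.2).add (ha.smul_const y)
    have e : σ • (y - w.2) = -σ • w.2 + σ • y := by rw [smul_sub, neg_smul]; abel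
    rw [e]
    exact this
  have h2 := ((hu.differentiable (by simp)) (auxPhi d (σ * τ) y w)).hasFDerivAt.comp_hasDerivAt τ h1
  rw [aux_fderiv_sp] at h2
  have e : σ * ∑ j, (y - w.2) j * spDeriv d j u (auxPhi d (σ * τ) y w) =
      ∑ j, (σ • (y - w.2)) j * spDeriv d j u (auxPhi d (σ * τ) y w) := by
    rw [Finset.mul_sum]
    simp [mul_assoc]
  rw [e]
  exact h2

lemma aux_hess_cont {d : ℕ} {u : Pt d → ℝ} (hu : ContDiff ℝ (⊤ : ℕ∞) u) :
    Continuous (hessNorm d u) := by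
  unfold hessNorm
  have := fun i j => (aux_sp_smooth (aux_sp_smooth hu j) i).continuous
  fun_prop

lemma aux_hess_entry {d : ℕ} (u : Pt d → ℝ) (z : Pt d) (i j : Fin d) :
    |spDeriv d i (spDeriv d j u) z| ≤ hessNorm d u z := by
  unfold hessNorm
  apply Real.abs_le_sqrt
  refine le_trans ?_ (Finset.single_le_sum
    (f := fun i => ∑ j, spDeriv d i (spDeriv d j u) z ^ 2)
    (fun i _ => Finset.sum_nonneg fun j _ => sq_nonneg _) (Finset.mem_univ i))
  exact Finset.single_le_sum (f := fun j => spDeriv d i (spDeriv d j u) z ^ 2)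
    (fun j _ => sq_nonneg _) (Finset.mem_univ j)

lemma aux_dir {d : ℕ} {u : Pt d → ℝ} (hu : ContDiff ℝ (⊤ : ℕ∞) u) {σ R : ℝ} (hσ : 0 < σ)
    {y : Ed d} (hy : ‖y‖ < R) {w : Pt d} (hw : w ∈ pCyl d R 0) :
    ENNReal.ofReal |σ * ∑ j, (y - w.2) j * spDeriv d j u w| ≤
      ENNReal.ofReal |u w| + ENNReal.ofReal |u (auxPhi d σ y w)| +
        ENNReal.ofReal (4 * σ ^ 2 * R ^ 2 * d ^ 2) *
        ∫⁻ τ in Icc (0:ℝ) 1, ENNReal.ofReal (hessNorm d u (auxPhi d (σ * τ) y w)) := by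
  have hR : 0 < R := (norm_nonneg _).trans_lt hy
  set v : Ed d := y - w.2 with hv
  have hvn : ‖v‖ ≤ 2 * R := by
    have h := hw.1
    simp only [Prod.snd_zero, dist_zero_left] at h
    have := norm_sub_le y w.2
    linarith
  have hvi : ∀ i, |v i| ≤ 2 * R := fun i => (PiLp.norm_apply_le v i).trans hvn
  have hΦ : Continuous fun τ => auxPhi d (σ * τ) y w := by unfold auxPhi; fun_prop
  have T := aux_taylor (G := fun τ => u (auxPhi d (σ * τ) y w))
    (G1 := fun τ => σ * ∑ j, v j * spDeriv d j u (auxPhi d (σ * τ) y w))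
    (G2 := fun τ => σ * ∑ j, v j * (σ * ∑ i, v i * spDeriv d i (spDeriv d j u)
      (auxPhi d (σ * τ) y w)))
    (fun τ => aux_Phi_deriv hu σ y w τ)
    (fun τ => (HasDerivAt.fun_sum fun j _ =>
      ((aux_Phi_deriv (aux_sp_smooth hu j) σ y w τ).const_mul (v j))).const_mul σ)
    (by
      have := fun i j => (aux_sp_smooth (aux_sp_smooth hu j) i).continuous.comp hΦ
      simp only [Function.comp_def] at this
      fun_prop)
  have hz : auxPhi d (σ * 0) y w = w := by simp [auxPhi]
  simp only [hz, mul_one] at T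
  refine T.trans ?_
  gcongr
  rw [← lintegral_const_mul' _ _ ENNReal.ofReal_ne_top]
  gcongr with τ
  rw [← ENNReal.ofReal_mul (by positivity)]
  apply ENNReal.ofReal_le_ofReal
  set z := auxPhi d (σ * τ) y w
  have hn : 0 ≤ hessNorm d u z := Real.sqrt_nonneg _
  calc |σ * ∑ j, v j * (σ * ∑ i, v i * spDeriv d i (spDeriv d j u) z)|
      ≤ σ * ∑ j : Fin d, (2 * R) * (σ * ∑ i : Fin d, (2 * R) * hessNorm d u z) := by
        rw [abs_mul, abs_of_pos hσ]
        gcongr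
        refine (Finset.abs_sum_le_sum_abs _ _).trans ?_
        gcongr with j
        rw [abs_mul, abs_mul, abs_of_pos hσ]
        gcongr
        · exact hvi j
        refine (Finset.abs_sum_le_sum_abs _ _).trans ?_
        gcongr with i
        rw [abs_mul]
        gcongr
        · exact hvi i
        · exact aux_hess_entry u z i j
    _ = _ := by
        simp only [Finset.sum_const, Finset.card_univ, Fintype.card_fin, nsmul_eq_mul]
        ring

lemma aux_morrey_dir {d : ℕ} {p β : ℝ} (hp : 1 < p) {u : Pt d → ℝ} (hu : ContDiff ℝ (⊤ : ℕ∞) u)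
    {σ R : ℝ} (hσ : 0 < σ) (hσ1 : σ ≤ 1 / 2) {y : Ed d} (hy : ‖y‖ < R) :
    MorreyNorm d p β (pCyl d R 0)
      (fun w => ENNReal.ofReal |σ * ∑ j, (y - w.2) j * spDeriv d j u w|) ≤
    (1 + 2 ^ d) * MorreyNorm d p β (pCyl d R 0) (fun z => ENNReal.ofReal |u z|) +
      ENNReal.ofReal (4 * σ ^ 2 * R ^ 2 * d ^ 2) * (2 ^ d * MorreyNorm d p β (pCyl d R 0)
        (fun z => ENNReal.ofReal (hessNorm d u z))) := by
  have hQ := aux_meas_cyl d R 0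
  have hm1 : Measurable fun z => ENNReal.ofReal |u z| := by
    have := hu.continuous
    exact this.abs.measurable.ennreal_ofReal
  have hmh : Measurable fun z => ENNReal.ofReal (hessNorm d u z) :=
    (aux_hess_cont hu).measurable.ennreal_ofReal
  have hΦ : ∀ s, Measurable (auxPhi d s y) := fun s => by unfold auxPhi; fun_prop
  have hm2 : Measurable fun z => ENNReal.ofReal |u (auxPhi d σ y z)| := hm1.comp (hΦ σ)
  have hm3 : Measurable (Function.uncurry fun (τ : ℝ) (w : Pt d) =>
      ENNReal.ofReal (hessNorm d u (auxPhi d (σ * τ) y w))) := by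
    have : Measurable fun q : ℝ × Pt d => auxPhi d (σ * q.1) y q.2 := by unfold auxPhi; fun_prop
    exact hmh.comp this
  have hm4 : Measurable fun w => ∫⁻ τ in Icc (0:ℝ) 1,
      ENNReal.ofReal (hessNorm d u (auxPhi d (σ * τ) y w)) := hm3.lintegral_prod_left'
  refine (aux_morrey_mono hp fun w hw => aux_dir hu hσ hy hw).trans ?_
  refine (aux_morrey_add hp hQ (hm1.add hm2) (hm4.const_mul _)).trans ?_
  refine add_le_add ((aux_morrey_add hp hQ hm1 hm2).trans ?_)
    ((aux_morrey_const hp _ ENNReal.ofReal_ne_top _).trans ?_)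
  · rw [add_mul, one_mul]
    gcongr
    exact aux_morrey_Phi (f := fun z => ENNReal.ofReal |u z|) hp hσ.le hσ1 hy hm1
  · gcongr
    refine aux_morrey_int hp hQ hm3 _ fun τ hτ => ?_
    exact aux_morrey_Phi (f := fun z => ENNReal.ofReal (hessNorm d u z)) hp
      (mul_nonneg hσ.le hτ.1) (by nlinarith [hτ.1, hτ.2]) hy hmh

lemma aux_morrey_i {d : ℕ} {p β : ℝ} (hp : 1 < p) {u : Pt d → ℝ} (hu : ContDiff ℝ (⊤ : ℕ∞) u)
    {σ R : ℝ} (hR : 0 < R) (hσ : 0 < σ) (hσ1 : σ ≤ 1 / 2) (i : Fin d) :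
    MorreyNorm d p β (pCyl d R 0) (fun w => ENNReal.ofReal |spDeriv d i u w|) ≤
    ENNReal.ofReal (2 / (σ * R)) * (2 * ((1 + 2 ^ d) *
      MorreyNorm d p β (pCyl d R 0) (fun z => ENNReal.ofReal |u z|) +
      ENNReal.ofReal (4 * σ ^ 2 * R ^ 2 * d ^ 2) * (2 ^ d * MorreyNorm d p β (pCyl d R 0)
        (fun z => ENNReal.ofReal (hessNorm d u z))))) := by
  have hQ := aux_meas_cyl d R 0
  set y : Ed d := EuclideanSpace.single i (R / 2) with hy
  have hyn : ‖y‖ < R := by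
    rw [hy, EuclideanSpace.norm_single, Real.norm_of_nonneg (by linarith)]; linarith
  have hm : ∀ y : Ed d, Measurable fun w : Pt d =>
      ENNReal.ofReal |σ * ∑ j, (y - w.2) j * spDeriv d j u w| := by
    intro y
    have := fun j => (aux_sp_smooth hu j).continuous
    have h : Continuous fun w : Pt d => |σ * ∑ j, (y - w.2) j * spDeriv d j u w| := by
      fun_prop
    exact h.measurable.ennreal_ofReal
  rw [two_mul]
  refine le_trans ?_ (mul_le_mul_right (add_le_add (aux_morrey_dir hp hu hσ hσ1 hyn)
    (aux_morrey_dir hp hu hσ hσ1 (y := 0) (by simpa using hR))) _)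
  refine le_trans ?_ (mul_le_mul_right (aux_morrey_add hp hQ (hm y) (hm 0)) _)
  refine le_trans ?_ (aux_morrey_const hp _ ENNReal.ofReal_ne_top _)
  refine aux_morrey_mono hp fun w _ => ?_
  rw [← ENNReal.ofReal_add (abs_nonneg _) (abs_nonneg _), ← ENNReal.ofReal_mul (by positivity)]
  apply ENNReal.ofReal_le_ofReal
  have e : spDeriv d i u w = 2 / (σ * R) * (σ * ∑ j, (y - w.2) j * spDeriv d j u w -
      σ * ∑ j, ((0 : Ed d) - w.2) j * spDeriv d j u w) := by
    rw [← mul_sub, ← Finset.sum_sub_distrib]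
    have : ∀ j, (y - w.2) j * spDeriv d j u w - ((0 : Ed d) - w.2) j * spDeriv d j u w =
        if j = i then R / 2 * spDeriv d j u w else 0 := by
      intro j
      simp only [hy, PiLp.sub_apply, PiLp.zero_apply, EuclideanSpace.single_apply]
      split_ifs <;> ring
    simp only [this]
    simp
    field_simp
  calc |spDeriv d i u w| = _ := by rw [e]
    _ ≤ _ := by
      rw [abs_mul, abs_of_pos (by positivity : 0 < 2 / (σ * R))]
      gcongr
      exact abs_sub _ _

lemma aux_morrey_sum {d : ℕ} {p β : ℝ} (hp : 1 < p) {Q : Set (Pt d)} (hQ : MeasurableSet Q)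
    {ι : Type} (s : Finset ι) (f : ι → Pt d → ℝ≥0∞) (hf : ∀ i, Measurable (f i)) (C : ℝ≥0∞)
    (h : ∀ i, MorreyNorm d p β Q (f i) ≤ C) :
    MorreyNorm d p β Q (fun w => ∑ i ∈ s, f i w) ≤ s.card * C := by
  classical
  induction s using Finset.induction_on with
  | empty =>
    rw [aux_le_morrey hp]
    intro ρ _ z _
    have : 0 < p := by linarith
    simp [pAvg, this]
  | insert a s ha ih =>
    simp only [Finset.sum_insert ha, Finset.card_insert_of_notMem ha]
    refine (aux_morrey_add hp hQ (hf a) (Finset.measurable_fun_sum s fun i _ => hf i)).trans ?_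
    push_cast
    rw [add_mul, one_mul, add_comm]
    exact add_le_add ih (h a)

lemma aux_grad_le {d : ℕ} (u : Pt d → ℝ) (z : Pt d) :
    gradNorm d u z ≤ ∑ i, |spDeriv d i u z| := by
  unfold gradNorm
  apply Real.sqrt_le_iff.2
  refine ⟨Finset.sum_nonneg fun _ _ => abs_nonneg _, ?_⟩
  have := Finset.sum_sq_le_sq_sum_of_nonneg (s := Finset.univ)
    (f := fun i => |spDeriv d i u z|) (fun _ _ => abs_nonneg _)
  simpa using this

/-- Lemma 3.9, (3.9): for `p ∈ (1,∞)`, `0 < β ≤ (d+2)/p` there is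
`N = N(d,p,β)` such that for all `R ∈ (0,∞)`, `ε ∈ (0,1]`, `u ∈ C_0^∞`,
`‖Du‖_{E_{p,β}(C_R)} ≤ N ε R ‖|∂_t u|+|D²u|‖_{E_{p,β}(C_R)} + N ε⁻¹ R⁻¹ ‖u‖_{E_{p,β}(C_R)}`. -/
theorem stmt10 (d : ℕ) (hd : 1 ≤ d) (p β : ℝ) (hp : 1 < p)
    (hβ : 0 < β) (hβ' : β ≤ ((d : ℝ) + 2) / p) :
    ∃ N : ℝ, 0 < N ∧ ∀ R : ℝ, 0 < R → ∀ ε : ℝ, 0 < ε → ε ≤ 1 →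
      ∀ u : Pt d → ℝ, ContDiff ℝ (⊤ : ℕ∞) u → HasCompactSupport u →
        MorreyNorm d p β (pCyl d R 0) (fun z => ENNReal.ofReal (gradNorm d u z)) ≤
          ENNReal.ofReal (N * ε * R) * MorreyNorm d p β (pCyl d R 0)
              (fun z => ENNReal.ofReal (|timeDeriv d u z| + hessNorm d u z)) +
            ENNReal.ofReal (N * ε⁻¹ * R⁻¹) * MorreyNorm d p β (pCyl d R 0)
              (fun z => ENNReal.ofReal |u z|) := by

  have hd0 : (1:ℝ) ≤ d := by exact_mod_cast hd
  refine ⟨d * (8 * (1 + 2 ^ d) + 8 * d ^ 2 * 2 ^ d), by positivity, ?_⟩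
  intro R hR ε hε hε1 u hu _
  have hσ : 0 < ε / 2 := by linarith
  have hm : ∀ i, Measurable fun w => ENNReal.ofReal |spDeriv d i u w| := fun i =>
    (aux_sp_smooth hu i).continuous.abs.measurable.ennreal_ofReal
  have h1 : MorreyNorm d p β (pCyl d R 0) (fun z => ENNReal.ofReal (gradNorm d u z)) ≤
      MorreyNorm d p β (pCyl d R 0) (fun z => ∑ i, ENNReal.ofReal |spDeriv d i u z|) := by
    refine aux_morrey_mono hp fun w _ => ?_
    rw [← ENNReal.ofReal_sum_of_nonneg fun _ _ => abs_nonneg _]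
    exact ENNReal.ofReal_le_ofReal (aux_grad_le u w)
  have h2 := aux_morrey_sum hp (aux_meas_cyl d R 0) Finset.univ _ hm _
    (fun i => aux_morrey_i (β := β) hp hu hR hσ (by linarith) i)
  have h3 : MorreyNorm d p β (pCyl d R 0) (fun z => ENNReal.ofReal (hessNorm d u z)) ≤
      MorreyNorm d p β (pCyl d R 0)
        (fun z => ENNReal.ofReal (|timeDeriv d u z| + hessNorm d u z)) :=
    aux_morrey_mono hp fun w _ => ENNReal.ofReal_le_ofReal (by
      have := abs_nonneg (timeDeriv d u w)
      linarith)
  refine (h1.trans h2).trans ?_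
  generalize MorreyNorm d p β (pCyl d R 0) (fun z => ENNReal.ofReal (hessNorm d u z)) = H at h3 ⊢
  generalize MorreyNorm d p β (pCyl d R 0)
        (fun z => ENNReal.ofReal (|timeDeriv d u z| + hessNorm d u z)) = F at h3 ⊢
  generalize MorreyNorm d p β (pCyl d R 0) (fun z => ENNReal.ofReal |u z|) = U
  have c1 : ENNReal.ofReal (d * (2 / (ε / 2 * R)) * 2 * (4 * (ε / 2) ^ 2 * R ^ 2 * d ^ 2) * 2 ^ d) =
      d * ENNReal.ofReal (2 / (ε / 2 * R)) * 2 *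
        ENNReal.ofReal (4 * (ε / 2) ^ 2 * R ^ 2 * d ^ 2) * 2 ^ d := by
    rw [ENNReal.ofReal_mul (by positivity), ENNReal.ofReal_mul (by positivity),
      ENNReal.ofReal_mul (by positivity), ENNReal.ofReal_mul (by positivity),
      ENNReal.ofReal_pow (by norm_num)]
    simp
  have c2 : ENNReal.ofReal (d * (2 / (ε / 2 * R)) * 2 * (1 + 2 ^ d)) =
      d * ENNReal.ofReal (2 / (ε / 2 * R)) * 2 * (1 + 2 ^ d) := by
    rw [ENNReal.ofReal_mul (by positivity), ENNReal.ofReal_mul (by positivity),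
      ENNReal.ofReal_mul (by positivity), ENNReal.ofReal_add (by positivity) (by positivity),
      ENNReal.ofReal_pow (by norm_num)]
    simp
  calc _ = ENNReal.ofReal (d * (2 / (ε / 2 * R)) * 2 * (4 * (ε / 2) ^ 2 * R ^ 2 * d ^ 2) * 2 ^ d)
          * H + ENNReal.ofReal (d * (2 / (ε / 2 * R)) * 2 * (1 + 2 ^ d)) * U := by
        rw [c1, c2]
        simp only [Finset.card_univ, Fintype.card_fin]
        ring
    _ ≤ _ := by
        have k1 : (d:ℝ) * (2 / (ε / 2 * R)) * 2 * (4 * (ε / 2) ^ 2 * R ^ 2 * d ^ 2) * 2 ^ d ≤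
            d * (8 * (1 + 2 ^ d) + 8 * d ^ 2 * 2 ^ d) * ε * R := by
          have : (d:ℝ) * (2 / (ε / 2 * R)) * 2 * (4 * (ε / 2) ^ 2 * R ^ 2 * d ^ 2) * 2 ^ d =
            d * (8 * d ^ 2 * 2 ^ d) * ε * R := by field_simp; ring
          rw [this]
          gcongr
          have : (0:ℝ) ≤ 8 * (1 + 2 ^ d) := by positivity
          linarith
        have k2 : (d:ℝ) * (2 / (ε / 2 * R)) * 2 * (1 + 2 ^ d) ≤
            d * (8 * (1 + 2 ^ d) + 8 * d ^ 2 * 2 ^ d) * ε⁻¹ * R⁻¹ := by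
          have : (d:ℝ) * (2 / (ε / 2 * R)) * 2 * (1 + 2 ^ d) =
            d * (8 * (1 + 2 ^ d)) * ε⁻¹ * R⁻¹ := by field_simp; ring
          rw [this]
          gcongr
          have : (0:ℝ) ≤ 8 * (d:ℝ) ^ 2 * 2 ^ d := by positivity
          linarith
        exact add_le_add (mul_le_mul' (ENNReal.ofReal_le_ofReal k1) h3)
          (mul_le_mul' (ENNReal.ofReal_le_ofReal k2) le_rfl)
end
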